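/- Let m and n be positive integers with mn ≡ 8 (mod 16) such that both m and n are even, and let λ_a ∈ {2,3}; if λ_a = 3, assume additionally that (m,n) is not one of (2,12), (4,6), (6,4), (6,12), (12,2), (12,6). Then every (m,n,3,λ_a,1)-OOSPC has at most ⌊(13mn+40+32ω)/64⌋ codewords. -/

import Mathlib

open Finset

/-- An (m,n,k,lamA,lamC)-OOSPC: a family of k-subsets of Z_m x Z_n with
auto-correlation at most lamA and cross-correlation at most lamC. -/
def OOSPC (m n k lamA lamC : ℕ) (F : Finset (Finset (ZMod m × ZMod n))) : Prop :=
  (∀ X ∈ F, X.card = k) ∧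
  (∀ X ∈ F, ∀ g : ZMod m × ZMod n, g ≠ 0 →
    (X ∩ X.image (fun x => g + x)).card ≤ lamA) ∧
  (∀ X ∈ F, ∀ Y ∈ F, X ≠ Y → ∀ g : ZMod m × ZMod n,
    (X ∩ Y.image (fun x => g + x)).card ≤ lamC)

/-- The leave of a family: nonzero elements of Z_m x Z_n not occurring as a
difference of two elements of a member of the family. -/
def leave (m n : ℕ) (F : Finset (Finset (ZMod m × ZMod n))) : Set (ZMod m × ZMod n) :=
  {g | g ≠ 0 ∧ ∀ X ∈ F, ∀ x ∈ X, ∀ y ∈ X, x - y ≠ g}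

/-- (s,t)-regularity: the leave together with 0 equals S × T, where S and T are the
unique subgroups of order s of Z_m and of order t of Z_n (for s ∣ m, t ∣ n these are
exactly the elements killed by s, resp. t). -/
def Regular (m n s t : ℕ) (F : Finset (Finset (ZMod m × ZMod n))) : Prop :=
  insert (0 : ZMod m × ZMod n) (leave m n F) =
    {p : ZMod m × ZMod n | s • p.1 = 0 ∧ t • p.2 = 0}

/-- ξ: the number of subgroups of order 3 in Z_m × Z_n. -/
def xi (m n : ℕ) : ℕ := if 3 ∣ m ∧ 3 ∣ n then 4 else if 3 ∣ m * n then 1 else 0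

/-- ω = 0 if lamA = 2, and ω = ξ if lamA = 3. -/
def omega (lamA m n : ℕ) : ℕ := if lamA = 2 then 0 else xi m n

/-- The set of nonzero differences of a finite subset of an additive group. -/
def differences {G : Type*} [AddCommGroup G] [DecidableEq G] (X : Finset G) : Finset G :=
  X.offDiag.image fun p => p.1 - p.2

theorem mem_differences {G : Type*} [AddCommGroup G] [DecidableEq G] {X : Finset G} {g : G} :
    g ∈ differences X ↔ ∃ x ∈ X, ∃ y ∈ X, x ≠ y ∧ x - y = g := by
  simp only [differences, mem_image, mem_offDiag, Prod.exists]
  tauto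

theorem disjoint_differences {G : Type*} [AddCommGroup G] [DecidableEq G] {X Y : Finset G}
    (h : ∀ g : G, (X ∩ Y.image (fun x => g + x)).card ≤ 1) :
    Disjoint (differences X) (differences Y) := by
  rw [Finset.disjoint_left]
  intro g hX hY
  obtain ⟨x, hx, y, hy, hxy, rfl⟩ := mem_differences.1 hX
  obtain ⟨x', hx', y', hy', -, he⟩ := mem_differences.1 hY
  refine hxy (Finset.card_le_one.1 (h (x - x')) x ?_ y ?_)
  · exact mem_inter.2 ⟨hx, mem_image.2 ⟨x', hx', by abel⟩⟩
  · refine mem_inter.2 ⟨hy, mem_image.2 ⟨y', hy', ?_⟩⟩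
    have : x' = x - y + y' := by rw [← he]; abel
    rw [this]; abel

/-- Dual weight of a residue class modulo the subgroup of elements of odd order. -/
def classWeight (p : ZMod 4 × ZMod 2) : ℕ :=
  if 2 • p ≠ 0 then 1 else if p = (2, 0) then 3 else 2

/-- Extra weight of the involution lying in a given residue class. -/
def involutionBonus (p : ZMod 4 × ZMod 2) : ℕ :=
  if 2 • p ≠ 0 ∨ p = 0 then 0 else if p = (2, 0) then 3 else 2

/-- Weight of a group element: that of its residue class, a bonus for involutions and,
if `t` holds, a bonus for elements of order three. -/
def weight {G : Type*} [AddCommGroup G] [DecidableEq G] (φ : G →+ ZMod 4 × ZMod 2)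
    (t : Prop) [Decidable t] (g : G) : ℕ :=
  classWeight (φ g) + (if 2 • g = 0 then involutionBonus (φ g) else 0) +
    (if t ∧ 3 • g = 0 then 2 else 0)

theorem eight_mul_sum_classWeight {G : Type*} [AddCommGroup G] [Fintype G]
    {φ : G →+ ZMod 4 × ZMod 2} (hs : Function.Surjective φ) :
    8 * ∑ g : G, classWeight (φ g) = 13 * Fintype.card G := by
  have hfib : ∀ p, (univ.filter fun g => φ g = p).card = (univ.filter fun g => φ g = 0).card :=
    fun p => AddMonoidHom.card_fiber_eq_of_mem_range φ (hs p) (hs 0)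
  have h₁ : ∑ g : G, classWeight (φ g) =
      ∑ p : ZMod 4 × ZMod 2, (univ.filter fun g => φ g = 0).card * classWeight p := by
    rw [← Finset.sum_fiberwise univ φ]
    refine Finset.sum_congr rfl fun p _ => ?_
    rw [Finset.sum_congr rfl (g := fun _ => classWeight p)
      (fun g hg => by rw [(mem_filter.1 hg).2]), sum_const, hfib, smul_eq_mul]
  have h₂ : Fintype.card G =
      ∑ p : ZMod 4 × ZMod 2, (univ.filter fun g => φ g = 0).card := by
    rw [← Finset.card_univ, Finset.card_eq_sum_card_fiberwise (f := φ) (t := univ) (by simp)]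
    exact Finset.sum_congr rfl fun p _ => hfib p
  have h₃ : ∑ p : ZMod 4 × ZMod 2, classWeight p = 13 := by decide
  have h₄ : Fintype.card (ZMod 4 × ZMod 2) = 8 := by decide
  rw [h₁, ← Finset.mul_sum, h₃, h₂, sum_const, Finset.card_univ, h₄, smul_eq_mul]
  ring

section

variable {G : Type*} [AddCommGroup G] [DecidableEq G] {φ : G →+ ZMod 4 × ZMod 2}
  {t : Prop} [Decidable t]

theorem classWeight_le_weight (g : G) : classWeight (φ g) ≤ weight φ t g := by
  unfold weight; omega

theorem weight_of_two_nsmul_eq_zero (hφ : ∀ g : G, 2 • g = 0 → φ g = 0 → g = 0) {g : G}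
    (hg : g ≠ 0) (h2 : 2 • g = 0) :
    4 ≤ weight φ t g ∧ (φ g = (2, 0) → 6 ≤ weight φ t g) := by
  have h0 : φ g ≠ 0 := fun h => hg (hφ g h2 h)
  have h2' : 2 • φ g = 0 := by rw [← map_nsmul, h2, map_zero]
  have key : ∀ p : ZMod 4 × ZMod 2, p ≠ 0 → 2 • p = 0 →
      4 ≤ classWeight p + involutionBonus p ∧
        (p = (2, 0) → 6 ≤ classWeight p + involutionBonus p) := by decide
  have := key _ h0 h2'
  simp only [weight, h2, if_true]
  exact ⟨by omega, fun h => by have := this.2 h; omega⟩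

/-- A set of differences containing an involution has weight at least eight. -/
theorem eight_le_sum_weight_of_involution (hφ : ∀ g : G, 2 • g = 0 → φ g = 0 → g = 0)
    {D : Finset G} (hD : ∀ g ∈ D, -g ∈ D) {a b c : G} (ha : a ∈ D) (hb : b ∈ D) (hc : c ∈ D)
    (ha0 : a ≠ 0) (hb0 : b ≠ 0) (hc0 : c ≠ 0) (habc : a + b + c = 0) (h2 : 2 • a = 0) :
    8 ≤ ∑ g ∈ D, weight φ t g := by
  have sub : ∀ S : Finset G, S ⊆ D → ∑ g ∈ S, weight φ t g ≤ ∑ g ∈ D, weight φ t g :=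
    fun S hS => Finset.sum_le_sum_of_subset hS
  have hWa := weight_of_two_nsmul_eq_zero (t := t) hφ ha0 h2
  have hna : -a = a := by rw [two_nsmul] at h2; exact neg_eq_of_add_eq_zero_left h2
  have hcab : c = -(a + b) := by rw [eq_neg_iff_add_eq_zero, add_comm]; exact habc
  have hab : a ≠ b := by
    rintro rfl
    rw [← two_nsmul, h2, neg_zero] at hcab
    exact hc0 hcab
  by_cases h2b : 2 • b = 0
  · have hWb := weight_of_two_nsmul_eq_zero (t := t) hφ hb0 h2b
    have := sub {a, b} (by simp [insert_subset_iff, ha, hb])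
    rw [sum_pair hab] at this
    omega
  have hbn : b ≠ -b := fun h => h2b (by rw [two_nsmul]; nth_rw 2 [h]; simp)
  have habn : a ≠ -b := fun h => hab (by rw [← hna, h, neg_neg])
  have e3 := sub {a, b, -b} (by simp [insert_subset_iff, ha, hb, hD b hb])
  rw [sum_insert (by simp [hab, habn]), sum_pair hbn] at e3
  have hwb := classWeight_le_weight (φ := φ) (t := t) b
  have hwnb := classWeight_le_weight (φ := φ) (t := t) (-b)
  have neg : ∀ p : ZMod 4 × ZMod 2, classWeight (-p) = classWeight p := by decide
  have pos : ∀ p : ZMod 4 × ZMod 2, 1 ≤ classWeight p := by decide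
  rw [map_neg, neg] at hwnb
  have pb := pos (φ b)
  by_cases hz : φ a = (2, 0)
  · have := hWa.2 hz
    omega
  by_cases hb2 : 2 ≤ classWeight (φ b)
  · omega
  have hdouble : ∀ p : ZMod 4 × ZMod 2, ¬ 2 ≤ classWeight p → 2 • p = (2, 0) := by decide
  have h2φb := hdouble _ hb2
  have hcb : c ≠ b := by
    intro h
    apply hz
    have : a = -(2 • b) := by
      rw [eq_neg_iff_add_eq_zero, two_nsmul, ← add_assoc]; rw [h] at habc; exact habc
    rw [this, map_neg, map_nsmul, h2φb]
    decide
  have hcnb : c ≠ -b := fun h => ha0 (by rw [h] at habc; simpa using habc)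
  have h2c : 2 • c ≠ 0 := by
    rw [hcab, smul_neg, smul_add, h2, zero_add]
    simpa using h2b
  have hcn : c ≠ -c := fun h => h2c (by rw [two_nsmul]; nth_rw 2 [h]; simp)
  have hac : a ≠ c := fun h => h2c (h ▸ h2)
  have hanc : a ≠ -c := fun h => hac (by rw [← hna, h, neg_neg])
  have hbnc : b ≠ -c := fun h => hcnb (by rw [h, neg_neg])
  have e5 := sub {a, b, -b, c, -c}
    (by simp [insert_subset_iff, ha, hb, hD b hb, hc, hD c hc])
  rw [sum_insert (by simp [hab, habn, hac, hanc]),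
    sum_insert (by simp [hbn, hcb.symm, hbnc]), sum_insert (by simp [hcnb.symm, hcb.symm]),
    sum_pair hcn] at e5
  have := classWeight_le_weight (φ := φ) (t := t) c
  have := classWeight_le_weight (φ := φ) (t := t) (-c)
  have := pos (φ c)
  have := pos (φ (-c))
  omega

/-- A set of differences containing `±a` and `±2a` has weight at least eight, as has one
containing an element of order three if these carry a bonus. -/
theorem eight_le_sum_weight_of_double {D : Finset G} (hD : ∀ g ∈ D, -g ∈ D) {a : G}
    (ha : a ∈ D) (hc : 2 • a ∈ D) (h2 : 2 • a ≠ 0) (h4 : 4 • a ≠ 0) (h3 : 3 • a = 0 → t) :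
    8 ≤ ∑ g ∈ D, weight φ t g := by
  have sub : ∀ S : Finset G, S ⊆ D → ∑ g ∈ S, weight φ t g ≤ ∑ g ∈ D, weight φ t g :=
    fun S hS => Finset.sum_le_sum_of_subset hS
  have han : a ≠ -a := fun h => h2 (by rw [two_nsmul]; nth_rw 2 [h]; simp)
  by_cases h : 3 • a = 0
  · have ht := h3 h
    have e := sub {a, -a} (by simp [insert_subset_iff, ha, hD a ha])
    rw [sum_pair han] at e
    have two : ∀ p : ZMod 4 × ZMod 2, 3 • p = 0 → 2 ≤ classWeight p := by decide
    have hn : 3 • (-a) = 0 := by rw [smul_neg, h, neg_zero]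
    have w₁ := two (φ a) (by rw [← map_nsmul, h, map_zero])
    have w₂ := two (φ (-a)) (by rw [← map_nsmul, hn, map_zero])
    have w : ∀ x : G, 3 • x = 0 → classWeight (φ x) + 2 ≤ weight φ t x := fun x hx => by
      simp only [weight, ht, hx, and_self, if_true]
      omega
    have := w a h
    have := w (-a) hn
    omega
  · have hcn : (2 • a : G) ≠ -(2 • a) := fun h' => h4 (by
      rw [show (4 : ℕ) = 2 + 2 from rfl, add_nsmul]; exact add_eq_zero_iff_eq_neg.2 h')
    have hac : a ≠ 2 • a := by
      intro h'
      have : a = 0 := by rw [two_nsmul] at h'; simpa using h'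
      exact h2 (by simp [this])
    have hanc : a ≠ -(2 • a) := fun h' => h (by
      rw [show (3 : ℕ) = 1 + 2 from rfl, add_nsmul, one_nsmul]; nth_rw 1 [h']; simp)
    have hnac : -a ≠ 2 • a := fun h' => hanc (by rw [← h', neg_neg])
    have e := sub {a, -a, 2 • a, -(2 • a)}
      (by simp only [insert_subset_iff, singleton_subset_iff]
          exact ⟨ha, hD _ ha, hc, hD _ hc⟩)
    rw [sum_insert (by simp only [mem_insert, mem_singleton]; tauto),
      sum_insert (by simp only [mem_insert, mem_singleton, neg_inj]; tauto), sum_pair hcn] at e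
    have key : ∀ p : ZMod 4 × ZMod 2, 8 ≤ classWeight p + (classWeight (-p) +
      (classWeight (2 • p) + classWeight (-(2 • p)))) := by decide
    have := key (φ a)
    have w₁ := classWeight_le_weight (φ := φ) (t := t) a
    have w₂ := classWeight_le_weight (φ := φ) (t := t) (-a)
    have w₃ := classWeight_le_weight (φ := φ) (t := t) (2 • a)
    have w₄ := classWeight_le_weight (φ := φ) (t := t) (-(2 • a))
    rw [map_neg] at w₂ w₄
    rw [map_nsmul] at w₃ w₄
    omega

theorem eight_le_sum_weight (hφ : ∀ g : G, 2 • g = 0 → φ g = 0 → g = 0)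
    {D : Finset G} (hD : ∀ g ∈ D, -g ∈ D) {a b c : G} (ha : a ∈ D) (hb : b ∈ D) (hc : c ∈ D)
    (ha0 : a ≠ 0) (hb0 : b ≠ 0) (hc0 : c ≠ 0) (habc : a + b + c = 0)
    (h3 : 3 • a = 0 → a = b → t) :
    8 ≤ ∑ g ∈ D, weight φ t g := by
  by_cases h2a : 2 • a = 0
  · exact eight_le_sum_weight_of_involution hφ hD ha hb hc ha0 hb0 hc0 habc h2a
  by_cases h2b : 2 • b = 0
  · exact eight_le_sum_weight_of_involution hφ hD hb ha hc hb0 ha0 hc0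
      (by rw [← habc]; abel) h2b
  by_cases h2c : 2 • c = 0
  · exact eight_le_sum_weight_of_involution hφ hD hc ha hb hc0 ha0 hb0
      (by rw [← habc]; abel) h2c
  have double : ∀ x y : G, x ∈ D → y ∈ D → 2 • x ≠ 0 → 2 • y ≠ 0 → x + x + y = 0 →
      (3 • x = 0 → t) → 8 ≤ ∑ g ∈ D, weight φ t g := by
    intro x y hx hy h2x h2y h hx3
    have hxy : 2 • x = -y := by rw [two_nsmul]; exact eq_neg_of_add_eq_zero_left h
    refine eight_le_sum_weight_of_double hD hx (hxy ▸ hD y hy) h2x ?_ hx3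
    rw [show (4 : ℕ) = 2 * 2 from rfl, mul_nsmul, hxy, smul_neg]
    simpa using h2y
  have third : ∀ x y : G, x + x + y = 0 → 3 • x = 0 → x = y := by
    intro x y h h'
    have : 3 • x = x + x + x := by abel
    rw [this] at h'
    exact add_left_cancel (h'.trans h.symm)
  by_cases hab : a = b
  · exact double a c ha hc h2a h2c (by rw [← habc, hab]) (fun h => h3 h hab)
  by_cases hbc : b = c
  · have e : b + b + a = 0 := by rw [← habc, ← hbc]; abel
    exact double b a hb ha h2b h2a e (fun h => absurd (third _ _ e h).symm hab)
  by_cases hac : a = c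
  · have e : a + a + b = 0 := by rw [← habc, ← hac]; abel
    exact double a b ha hb h2a h2b e (fun h => absurd (third _ _ e h) hab)
  have self : ∀ x : G, 2 • x ≠ 0 → x ≠ -x := fun x h2 h =>
    h2 (by rw [two_nsmul]; nth_rw 2 [h]; simp)
  have hanb : a ≠ -b := fun h => hc0 (by simpa [h] using habc)
  have hanc : a ≠ -c := fun h => hb0 (by
    have : a + b + c = b + (a + c) := by abel
    rw [this, h] at habc; simpa using habc)
  have hbnc : b ≠ -c := fun h => ha0 (by simpa [h] using habc)
  have hna : ∀ x y : G, x ≠ -y → -x ≠ y := fun x y h h' => h (by rw [← h', neg_neg])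
  have e : ∑ g ∈ {a, -a, b, -b, c, -c}, weight φ t g ≤ ∑ g ∈ D, weight φ t g :=
    Finset.sum_le_sum_of_subset (by
      simp only [insert_subset_iff, singleton_subset_iff]
      exact ⟨ha, hD _ ha, hb, hD _ hb, hc, hD _ hc⟩)
  rw [sum_insert (by simp [self a h2a, hab, hanb, hac, hanc]),
    sum_insert (by simp [hna _ _ hanb, hab, hna _ _ hanc, hac]),
    sum_insert (by simp [self b h2b, hbc, hbnc]),
    sum_insert (by simp [hna _ _ hbnc, hbc]), sum_pair (self c h2c)] at e
  have key : ∀ p q : ZMod 4 × ZMod 2, 4 ≤ classWeight p + classWeight q +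
    classWeight (-(p + q)) := by decide
  have neg : ∀ p : ZMod 4 × ZMod 2, classWeight (-p) = classWeight p := by decide
  have k := key (φ a) (φ b)
  have hcab : c = -(a + b) := by rw [eq_neg_iff_add_eq_zero, add_comm]; exact habc
  rw [← map_add, ← map_neg, ← hcab] at k
  have w := classWeight_le_weight (φ := φ) (t := t)
  have w₁ := w (-a)
  have w₂ := w (-b)
  have w₃ := w (-c)
  rw [map_neg, neg] at w₁ w₂ w₃
  have := w a
  have := w b
  have := w c
  omega

theorem eight_le_sum_weight_differences (hφ : ∀ g : G, 2 • g = 0 → φ g = 0 → g = 0)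
    {X : Finset G} (hX : X.card = 3)
    (h3 : (∃ g : G, g ≠ 0 ∧ 2 < (X ∩ X.image (fun x => g + x)).card) → t) :
    8 ≤ ∑ g ∈ differences X, weight φ t g := by
  obtain ⟨x, y, z, hxy, hxz, hyz, rfl⟩ := card_eq_three.1 hX
  have mem : ∀ u ∈ ({x, y, z} : Finset G), ∀ v ∈ ({x, y, z} : Finset G), u ≠ v →
      u - v ∈ differences {x, y, z} := fun u hu v hv h =>
    mem_differences.2 ⟨u, hu, v, hv, h, rfl⟩
  refine eight_le_sum_weight hφ ?_ (a := x - y) (b := y - z) (c := z - x)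
    (mem _ (by simp) _ (by simp) hxy) (mem _ (by simp) _ (by simp) hyz)
    (mem _ (by simp) _ (by simp) hxz.symm) (sub_ne_zero.2 hxy) (sub_ne_zero.2 hyz)
    (sub_ne_zero.2 hxz.symm) (by abel) ?_
  · intro g hg
    obtain ⟨u, hu, v, hv, huv, rfl⟩ := mem_differences.1 hg
    rw [neg_sub]
    exact mem v hv u hu huv.symm
  · intro h hab
    refine h3 ⟨x - y, sub_ne_zero.2 hxy, ?_⟩
    have hsub : ({x, y, z} : Finset G) ⊆ image (fun u => x - y + u) {x, y, z} := by
      have hc : x - y = z - x := by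
        have : 3 • (x - y) = (x - y) + (x - y) + (x - y) := by abel
        rw [this] at h
        have h' : (x - y) + (x - y) + (z - x) = 0 := by nth_rw 2 [hab]; abel
        exact add_left_cancel (h.trans h'.symm)
      intro u hu
      simp only [mem_insert, mem_singleton] at hu
      rcases hu with rfl | rfl | rfl
      · exact mem_image.2 ⟨y, by simp, by abel⟩
      · exact mem_image.2 ⟨z, by simp, by rw [hab]; abel⟩
      · exact mem_image.2 ⟨x, by simp, by rw [hc]; abel⟩
    rw [inter_eq_left.2 hsub, hX]
    decide

theorem sum_involutionBonus_le [Fintype G] (hφ : ∀ g : G, 2 • g = 0 → φ g = 0 → g = 0) :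
    ∑ g : G, (if 2 • g = 0 then involutionBonus (φ g) else 0) ≤ 7 := by
  rw [← Finset.sum_filter]
  have hinj : Set.InjOn φ (univ.filter fun g : G => 2 • g = 0) := by
    intro x hx y hy h
    simp only [coe_filter, mem_univ, true_and, Set.mem_ofPred_eq] at hx hy
    refine sub_eq_zero.1 (hφ _ ?_ ?_)
    · rw [smul_sub, hx, hy, sub_zero]
    · rw [map_sub, h, sub_self]
  rw [← Finset.sum_image (f := involutionBonus) hinj]
  refine (Finset.sum_le_sum_of_subset (subset_univ _)).trans ?_
  decide

theorem card_family_le [Fintype G] (hs : Function.Surjective φ)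
    (hφ : ∀ g : G, 2 • g = 0 → φ g = 0 → g = 0) {F : Finset (Finset G)}
    (hcard : ∀ X ∈ F, X.card = 3)
    (hauto : ∀ X ∈ F, (∃ g : G, g ≠ 0 ∧ 2 < (X ∩ X.image (fun x => g + x)).card) → t)
    (hcross : ∀ X ∈ F, ∀ Y ∈ F, X ≠ Y → ∀ g : G, (X ∩ Y.image (fun x => g + x)).card ≤ 1) :
    64 * F.card + 16 * (if t then 1 else 0) ≤ 13 * Fintype.card G + 40 +
      16 * (if t then (univ.filter fun g : G => 3 • g = 0).card else 0) := by
  have h₁ : F.card * 8 ≤ ∑ X ∈ F, ∑ g ∈ differences X, weight φ t g := by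
    rw [← smul_eq_mul]
    exact Finset.card_nsmul_le_sum _ _ _ fun X hX =>
      eight_le_sum_weight_differences hφ (hcard X hX) (hauto X hX)
  have h₂ : ∑ g ∈ F.biUnion differences, weight φ t g ≤ ∑ g ∈ univ.erase 0, weight φ t g := by
    refine Finset.sum_le_sum_of_subset fun g hg => ?_
    obtain ⟨X, -, hg⟩ := mem_biUnion.1 hg
    obtain ⟨x, -, y, -, hxy, rfl⟩ := mem_differences.1 hg
    exact mem_erase.2 ⟨sub_ne_zero.2 hxy, mem_univ _⟩
  rw [Finset.sum_biUnion (fun X hX Y hY h =>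
    disjoint_differences (hcross X hX Y hY h))] at h₂
  have h₃ := Finset.add_sum_erase univ (weight φ t) (mem_univ 0)
  have h₄ : weight φ t 0 = 2 + 2 * (if t then 1 else 0) := by
    have e₁ : classWeight 0 = 2 := by decide
    have e₂ : involutionBonus 0 = 0 := by decide
    by_cases h : t <;> simp [weight, e₁, e₂, h]
  have h₅ : ∑ g : G, weight φ t g = ∑ g : G, classWeight (φ g) +
      ∑ g : G, (if 2 • g = 0 then involutionBonus (φ g) else 0) +
      2 * (if t then (univ.filter fun g : G => 3 • g = 0).card else 0) := by
    simp only [weight, Finset.sum_add_distrib]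
    congr 1
    by_cases h : t
    · simp only [h, true_and, if_true]
      rw [← Finset.sum_filter, sum_const, smul_eq_mul, mul_comm]
    · simp [h]
  have h₆ := eight_mul_sum_classWeight hs
  have h₇ := sum_involutionBonus_le hφ
  omega

end

theorem ZMod.eq_zero_of_castHom_eq_zero {d j : ℕ} (hj : Odd j) (x : ZMod (d * j))
    (h2 : 2 • x = 0) (h : ZMod.castHom (Dvd.intro j rfl) (ZMod d) x = 0) : x = 0 := by
  obtain ⟨k, rfl⟩ := ZMod.intCast_surjective x
  rw [map_intCast, ZMod.intCast_zmod_eq_zero_iff_dvd] at h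
  have h2' : ((2 * k : ℤ) : ZMod (d * j)) = 0 := by
    push_cast; rw [← h2, nsmul_eq_mul]; norm_num
  rw [ZMod.intCast_zmod_eq_zero_iff_dvd] at h2' ⊢
  obtain ⟨l, rfl⟩ := h
  push_cast at h2' ⊢
  rcases Nat.eq_zero_or_pos d with rfl | hd
  · simp
  have h₁ : (d : ℤ) * j ∣ d * (2 * l) := by convert h2' using 1; ring
  have h₂ := (mul_dvd_mul_iff_left (by exact_mod_cast hd.ne')).1 h₁
  have hc : IsCoprime (j : ℤ) 2 := by
    rw [show (2 : ℤ) = ((2 : ℕ) : ℤ) from rfl, Nat.isCoprime_iff_coprime]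
    exact hj.coprime_two_right
  exact mul_dvd_mul_left _ (hc.dvd_of_dvd_mul_left h₂)

theorem ZMod.exists_surjective_hom_of_even {m n : ℕ} (h16 : m * n % 16 = 8) (hm2 : 2 ∣ m)
    (hn2 : 2 ∣ n) : ∃ φ : ZMod m × ZMod n →+ ZMod 4 × ZMod 2, Function.Surjective φ ∧
      ∀ g, 2 • g = 0 → φ g = 0 → g = 0 := by
  have four : ∀ i j : ℕ, Odd i → Odd j → ∃ φ : ZMod (4 * i) × ZMod (2 * j) →+ ZMod 4 × ZMod 2,
      Function.Surjective φ ∧ ∀ g, 2 • g = 0 → φ g = 0 → g = 0 := by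
    intro i j hi hj
    have hi4 : 4 ∣ 4 * i := Dvd.intro i rfl
    have hj2 : 2 ∣ 2 * j := Dvd.intro j rfl
    refine ⟨AddMonoidHom.prodMap (ZMod.castHom hi4 (ZMod 4)).toAddMonoidHom
      (ZMod.castHom hj2 (ZMod 2)).toAddMonoidHom, ?_, ?_⟩
    · exact Function.Surjective.prodMap (ZMod.castHom_surjective hi4)
        (ZMod.castHom_surjective hj2)
    · intro g h h'
      exact Prod.ext (ZMod.eq_zero_of_castHom_eq_zero hi _ (congrArg Prod.fst h)
        (congrArg Prod.fst h')) (ZMod.eq_zero_of_castHom_eq_zero hj _ (congrArg Prod.snd h)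
        (congrArg Prod.snd h'))
  obtain ⟨a, rfl⟩ := hm2
  obtain ⟨b, rfl⟩ := hn2
  have hab : a * b % 4 = 2 := by
    have : 2 * a * (2 * b) = 4 * (a * b) := by ring
    omega
  rcases Nat.even_or_odd a with ha | ha
  · obtain ⟨i, rfl⟩ := ha.two_dvd
    have hib : Odd (i * b) := by
      rw [Nat.odd_iff]
      rw [mul_assoc] at hab
      omega
    rw [Nat.odd_mul] at hib
    rw [← mul_assoc]
    exact four i b hib.1 hib.2
  · rcases Nat.even_or_odd b with hb | hb
    · obtain ⟨j, rfl⟩ := hb.two_dvd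
      have haj : Odd (a * j) := by
        rw [Nat.odd_iff]
        rw [mul_left_comm] at hab
        omega
      rw [Nat.odd_mul] at haj
      obtain ⟨φ, hs, hφ⟩ := four j a haj.2 haj.1
      rw [← mul_assoc]
      refine ⟨φ.comp (AddEquiv.prodComm :
        ZMod (2 * a) × ZMod (2 * 2 * j) ≃+ ZMod (2 * 2 * j) × ZMod (2 * a)).toAddMonoidHom,
        hs.comp (AddEquiv.surjective _), fun g h h' => ?_⟩
      have := hφ (AddEquiv.prodComm g) (by rw [← map_nsmul, h, map_zero]) h'
      simpa [Prod.ext_iff, and_comm] using this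
    · have := Nat.odd_iff.1 (ha.mul hb)
      omega

theorem ZMod.card_three_nsmul_eq_zero_le (m : ℕ) [NeZero m] :
    (univ.filter fun x : ZMod m => 3 • x = 0).card ≤ if 3 ∣ m then 3 else 1 := by
  split_ifs with h
  · exact IsAddCyclic.card_nsmul_eq_zero_le (by norm_num)
  · refine Finset.card_le_one.2 fun x hx y hy => ?_
    have hu : IsUnit ((3 : ℕ) : ZMod m) := by
      rw [ZMod.isUnit_iff_coprime]
      exact (Nat.Prime.coprime_iff_not_dvd Nat.prime_three).2 h
    have zero : ∀ u ∈ univ.filter (fun x : ZMod m => 3 • x = 0), u = 0 := fun u hu' => by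
      have := (mem_filter.1 hu').2
      rw [nsmul_eq_mul] at this
      exact (hu.mul_right_eq_zero).1 this
    rw [zero x hx, zero y hy]

theorem card_three_nsmul_eq_zero_le_xi (m n : ℕ) [NeZero m] [NeZero n] :
    (univ.filter fun g : ZMod m × ZMod n => 3 • g = 0).card ≤ 1 + 2 * xi m n := by
  have h : (univ.filter fun g : ZMod m × ZMod n => 3 • g = 0) =
      (univ.filter fun x : ZMod m => 3 • x = 0) ×ˢ (univ.filter fun y : ZMod n => 3 • y = 0) := by
    ext g
    simp [Prod.ext_iff]
  rw [h, card_product]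
  refine (Nat.mul_le_mul (ZMod.card_three_nsmul_eq_zero_le m)
    (ZMod.card_three_nsmul_eq_zero_le n)).trans ?_
  unfold xi
  by_cases h₁ : 3 ∣ m <;> by_cases h₂ : 3 ∣ n <;> simp [Nat.prime_three.dvd_mul, h₁, h₂]

theorem stmt6 (m n lamA : ℕ) (hm : 0 < m) (hn : 0 < n)
    (h16 : m * n % 16 = 8) (hm2 : 2 ∣ m) (hn2 : 2 ∣ n)
    (hl : lamA = 2 ∨ lamA = 3)
    (hexc : lamA = 3 → (m, n) ≠ (2, 12) ∧ (m, n) ≠ (4, 6) ∧ (m, n) ≠ (6, 4) ∧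
      (m, n) ≠ (6, 12) ∧ (m, n) ≠ (12, 2) ∧ (m, n) ≠ (12, 6))
    (F : Finset (Finset (ZMod m × ZMod n))) (hF : OOSPC m n 3 lamA 1 F) :
    F.card ≤ (13 * m * n + 40 + 32 * omega lamA m n) / 64 := by
  have : NeZero m := ⟨hm.ne'⟩
  have : NeZero n := ⟨hn.ne'⟩
  obtain ⟨φ, hs, hφ⟩ := ZMod.exists_surjective_hom_of_even h16 hm2 hn2
  obtain ⟨hcard, hauto, hcross⟩ := hF
  have key := card_family_le (t := lamA = 3) hs hφ hcard (fun X hX ⟨g, hg, hlt⟩ => by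
    have := hauto X hX g hg
    omega) hcross
  have h3 := card_three_nsmul_eq_zero_le_xi m n
  rw [Fintype.card_prod, ZMod.card, ZMod.card, ← mul_assoc] at key
  rw [Nat.le_div_iff_mul_le (by norm_num)]
  rcases hl with rfl | rfl
  · simp only [omega, if_true]
    simp only [show ¬ (2 = 3) by decide, if_false] at key
    omega
  · simp only [omega, show ¬ (3 = 2) by decide, if_false]
    simp only [if_true] at key
    omega
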